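/- arXiv:2405.17380 — 4 statements merged into one kernel-verified Lean document; each statement's English description precedes it below -/
import Mathlib

section
/- Let I be a nonempty directed partially ordered set, and let (X_i, f_{i,j}) and (Y_i, g_{i,j}) be inverse systems of compact Hausdorff spaces over I, with inverse limits (X, π_i) and (Y, ρ_i). Then (X_i ∗ Y_i, f_{i,j} ∗ g_{i,j}) is again an inverse system of compact Hausdorff spaces over I, and the map Θ : X ∗ Y → lim_i (X_i ∗ Y_i) defined by Θ([t, x, y]) = ([t, π_i(x), ρ_i(y)])_{i ∈ I} is a well-defined homeomorphism. Moreover, if a group G acts by homeomorphisms on each X_i and each Y_i and every connecting map f_{i,j}, g_{i,j} is G-equivariant, then Θ is G-equivariant for the induced join actions g·[t, x, y] = [t, g·x, g·y]. -/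
/-- The relation generating the topological join: at `t = 0` the first coordinate is
collapsed, at `t = 1` the second coordinate is collapsed. -/
def JoinRel (X Y : Type*) :
    (unitInterval × X × Y) → (unitInterval × X × Y) → Prop := fun p q =>
  (p.1 = 0 ∧ q.1 = 0 ∧ p.2.2 = q.2.2) ∨ (p.1 = 1 ∧ q.1 = 1 ∧ p.2.1 = q.2.1)

/-- The topological join `X ∗ Y` of two topological spaces. -/
def TopJoin (X Y : Type*) : Type _ := Quot (JoinRel X Y)

instance TopJoin.topology (X Y : Type*) [TopologicalSpace X] [TopologicalSpace Y] :
    TopologicalSpace (TopJoin X Y) :=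
  inferInstanceAs (TopologicalSpace (Quot (JoinRel X Y)))

/-- The class `[t, x, y] ∈ X ∗ Y`. -/
def joinMk {X Y : Type*} (t : unitInterval) (x : X) (y : Y) : TopJoin X Y :=
  Quot.mk _ (t, x, y)

/-- The join `f ∗ g` of two maps, `[t,x,y] ↦ [t, f x, g y]`. -/
def TopJoin.map {X₁ X₂ Y₁ Y₂ : Type*} (f : X₁ → X₂) (g : Y₁ → Y₂) :
    TopJoin X₁ Y₁ → TopJoin X₂ Y₂ :=
  Quot.map (fun p => (p.1, f p.2.1, g p.2.2)) (fun p q h => by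
    rcases h with ⟨h1, h2, h3⟩ | ⟨h1, h2, h3⟩
    · exact Or.inl ⟨h1, h2, congrArg g h3⟩
    · exact Or.inr ⟨h1, h2, congrArg f h3⟩)

/-- The inverse limit of an inverse system `(X i, f i j)` over a preordered index set,
realized as the subspace of the product consisting of the compatible families. -/
abbrev InvLim {I : Type*} [Preorder I] (X : I → Type*)
    (f : ∀ i j : I, j ≤ i → X i → X j) : Type _ :=
  { x : ∀ i, X i // ∀ (i j : I) (h : j ≤ i), f i j h (x i) = x j }

theorem joinMk_eq_joinMk_iff {X Y : Type*} {t t' : unitInterval} {x x' : X} {y y' : Y} :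
    joinMk t x y = joinMk t' x' y' ↔ t = t' ∧ (t ≠ 0 → x = x') ∧ (t ≠ 1 → y = y') := by
  constructor
  · intro h
    have h' := Quot.eqvGen_exact h
    suffices H : ∀ p q : unitInterval × X × Y, Relation.EqvGen (JoinRel X Y) p q →
        p.1 = q.1 ∧ (p.1 ≠ 0 → p.2.1 = q.2.1) ∧ (p.1 ≠ 1 → p.2.2 = q.2.2) from H _ _ h'
    intro p q hpq
    induction hpq with
    | rel p q h =>
      rcases h with ⟨h1, h2, h3⟩ | ⟨h1, h2, h3⟩
      · exact ⟨h1.trans h2.symm, fun h => absurd h1 h, fun _ => h3⟩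
      · exact ⟨h1.trans h2.symm, fun _ => h3, fun h => absurd h1 h⟩
    | refl p => exact ⟨rfl, fun _ => rfl, fun _ => rfl⟩
    | symm p q _ ih =>
      obtain ⟨h1, h2, h3⟩ := ih
      exact ⟨h1.symm, fun h => (h2 (h1 ▸ h)).symm, fun h => (h3 (h1 ▸ h)).symm⟩
    | trans p q r _ _ ih₁ ih₂ =>
      obtain ⟨h1, h2, h3⟩ := ih₁
      obtain ⟨k1, k2, k3⟩ := ih₂
      exact ⟨h1.trans k1, fun h => (h2 h).trans (k2 (h1 ▸ h)),
        fun h => (h3 h).trans (k3 (h1 ▸ h))⟩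
  · rintro ⟨rfl, hx, hy⟩
    by_cases h0 : t = 0
    · have hy' : y = y' := hy (by rw [h0]; exact zero_ne_one)
      exact Quot.sound (Or.inl ⟨h0, h0, hy'⟩)
    · by_cases h1 : t = 1
      · exact Quot.sound (Or.inr ⟨h1, h1, hx h0⟩)
      · rw [hx h0, hy h1]

theorem joinMk_surjective {X Y : Type*} (z : TopJoin X Y) : ∃ t x y, joinMk t x y = z := by
  obtain ⟨⟨t, x, y⟩, h⟩ := Quot.exists_rep z
  exact ⟨t, x, y, h⟩

/-- The join parameter `[t, x, y] ↦ t`. -/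
def TopJoin.param {X Y : Type*} : TopJoin X Y → unitInterval :=
  Quot.lift (fun p => p.1) (by
    rintro p q (⟨h1, h2, -⟩ | ⟨h1, h2, -⟩) <;> exact h1.trans h2.symm)

/-- The function `[t, x, y] ↦ t * φ x`. -/
def TopJoin.scaleLeft {X Y : Type*} (φ : X → ℝ) : TopJoin X Y → ℝ :=
  Quot.lift (fun p => (p.1 : ℝ) * φ p.2.1) (by
    rintro p q (⟨h1, h2, -⟩ | ⟨h1, h2, h3⟩)
    · simp [h1, h2]
    · simp [h1, h2, h3])

/-- The function `[t, x, y] ↦ (1 - t) * φ y`. -/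
def TopJoin.scaleRight {X Y : Type*} (φ : Y → ℝ) : TopJoin X Y → ℝ :=
  Quot.lift (fun p => (1 - (p.1 : ℝ)) * φ p.2.2) (by
    rintro p q (⟨h1, h2, h3⟩ | ⟨h1, h2, -⟩)
    · simp [h1, h2, h3]
    · simp [h1, h2])

section Topology

variable {X Y Z : Type*} [TopologicalSpace X] [TopologicalSpace Y] [TopologicalSpace Z]

theorem continuous_joinMk :
    Continuous fun p : unitInterval × X × Y => (joinMk p.1 p.2.1 p.2.2 : TopJoin X Y) :=
  continuous_quot_mk

theorem TopJoin.continuous_of_comp_joinMk {F : TopJoin X Y → Z}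
    (h : Continuous fun p : unitInterval × X × Y => F (joinMk p.1 p.2.1 p.2.2)) :
    Continuous F :=
  continuous_coinduced_dom.2 h

theorem TopJoin.continuous_map {X' Y' : Type*} [TopologicalSpace X'] [TopologicalSpace Y']
    {f : X → X'} {g : Y → Y'} (hf : Continuous f) (hg : Continuous g) :
    Continuous (TopJoin.map f g) :=
  TopJoin.continuous_of_comp_joinMk <| continuous_joinMk.comp
    (f := fun p : unitInterval × X × Y => (p.1, f p.2.1, g p.2.2)) (by fun_prop)

instance TopJoin.compactSpace [CompactSpace X] [CompactSpace Y] : CompactSpace (TopJoin X Y) :=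
  inferInstanceAs (CompactSpace (Quot (JoinRel X Y)))

theorem TopJoin.continuous_param : Continuous (TopJoin.param : TopJoin X Y → unitInterval) :=
  TopJoin.continuous_of_comp_joinMk continuous_fst

theorem TopJoin.continuous_scaleLeft {φ : X → ℝ} (hφ : Continuous φ) :
    Continuous (TopJoin.scaleLeft φ : TopJoin X Y → ℝ) :=
  TopJoin.continuous_of_comp_joinMk
    (show Continuous fun p : unitInterval × X × Y => (p.1 : ℝ) * φ p.2.1 by fun_prop)

theorem TopJoin.continuous_scaleRight {φ : Y → ℝ} (hφ : Continuous φ) :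
    Continuous (TopJoin.scaleRight φ : TopJoin X Y → ℝ) :=
  TopJoin.continuous_of_comp_joinMk
    (show Continuous fun p : unitInterval × X × Y => (1 - (p.1 : ℝ)) * φ p.2.2 by fun_prop)

theorem exists_continuous_real_ne [NormalSpace X] [T1Space X] {x x' : X} (h : x ≠ x') :
    ∃ φ : X → ℝ, Continuous φ ∧ φ x ≠ φ x' := by
  obtain ⟨φ, h0, h1, -⟩ := exists_continuous_zero_one_of_isClosed
    (isClosed_singleton (x := x)) (isClosed_singleton (x := x'))
    (Set.disjoint_singleton.2 h)
  refine ⟨φ, φ.continuous, ?_⟩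
  rw [h0 rfl, h1 rfl]
  exact zero_ne_one

instance TopJoin.t2Space [NormalSpace X] [T1Space X] [NormalSpace Y] [T1Space Y] :
    T2Space (TopJoin X Y) := by
  refine ⟨fun z z' hne => ?_⟩
  obtain ⟨t, x, y, rfl⟩ := joinMk_surjective z
  obtain ⟨t', x', y', rfl⟩ := joinMk_surjective z'
  by_cases ht : t = t'
  · subst ht
    by_cases hx : t ≠ 0 → x = x'
    · have hy : ¬ (t ≠ 1 → y = y') := fun hy => hne (joinMk_eq_joinMk_iff.2 ⟨rfl, hx, hy⟩)
      push Not at hy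
      obtain ⟨φ, hφ, hφne⟩ := exists_continuous_real_ne hy.2
      refine separated_by_continuous (TopJoin.continuous_scaleRight hφ) ?_
      have h1 : 1 - (t : ℝ) ≠ 0 := sub_ne_zero.2 fun h => hy.1 (Subtype.ext h.symm)
      exact fun h => hφne (mul_left_cancel₀ h1 h)
    · push Not at hx
      obtain ⟨φ, hφ, hφne⟩ := exists_continuous_real_ne hx.2
      refine separated_by_continuous (TopJoin.continuous_scaleLeft hφ) ?_
      have h0 : (t : ℝ) ≠ 0 := fun h => hx.1 (Subtype.ext h)
      exact fun h => hφne (mul_left_cancel₀ h0 h)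
  · exact separated_by_continuous TopJoin.continuous_param ht

end Topology

theorem TopJoin.map_id_id {X Y : Type*} : TopJoin.map (id : X → X) (id : Y → Y) = id := by
  funext z
  obtain ⟨t, x, y, rfl⟩ := joinMk_surjective z
  rfl

theorem TopJoin.map_comp_map {X₁ X₂ X₃ Y₁ Y₂ Y₃ : Type*} (f : X₁ → X₂) (f' : X₂ → X₃)
    (g : Y₁ → Y₂) (g' : Y₂ → Y₃) :
    TopJoin.map f' g' ∘ TopJoin.map f g = TopJoin.map (f' ∘ f) (g' ∘ g) := by
  funext z
  obtain ⟨t, x, y, rfl⟩ := joinMk_surjective z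
  rfl

section InvLim

variable {I : Type*} [Preorder I] {Z : I → Type*} [∀ i, TopologicalSpace (Z i)]
  [∀ i, T2Space (Z i)] {f : ∀ i j : I, j ≤ i → Z i → Z j}

theorem isClosed_setOf_forall_le_map_eq (hf : ∀ i j h, Continuous (f i j h)) (i : I) :
    IsClosed {p : ∀ i, Z i | ∀ j (h : j ≤ i), f i j h (p i) = p j} := by
  have : {p : ∀ i, Z i | ∀ j (h : j ≤ i), f i j h (p i) = p j} =
      ⋂ (j) (h : j ≤ i), {p | f i j h (p i) = p j} := by
    ext p
    simp
  rw [this]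
  exact isClosed_iInter fun j => isClosed_iInter fun h =>
    isClosed_eq ((hf i j h).comp (continuous_apply i)) (continuous_apply j)

theorem InvLim.compactSpace [∀ i, CompactSpace (Z i)] (hf : ∀ i j h, Continuous (f i j h)) :
    CompactSpace (InvLim Z f) := by
  have h : IsClosed {p : ∀ i, Z i | ∀ (i j : I) (h : j ≤ i), f i j h (p i) = p j} := by
    have : {p : ∀ i, Z i | ∀ (i j : I) (h : j ≤ i), f i j h (p i) = p j} =
        ⋂ i, {p | ∀ j (h : j ≤ i), f i j h (p i) = p j} := by
      ext p
      simp
    rw [this]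
    exact isClosed_iInter fun i => isClosed_setOf_forall_le_map_eq hf i
  exact isCompact_iff_compactSpace.1 h.isCompact

/-- An inverse system of nonempty compact sets in compact Hausdorff spaces has a compatible
family of points. -/
theorem InvLim.exists_mem_of_isClosed [IsDirected I (· ≤ ·)] [Nonempty I]
    [∀ i, CompactSpace (Z i)] (hf : ∀ i j h, Continuous (f i j h))
    (hfid : ∀ i z, f i i le_rfl z = z)
    (hfcomp : ∀ (i j k : I) (hji : j ≤ i) (hkj : k ≤ j) (z : Z i),
      f j k hkj (f i j hji z) = f i k (hkj.trans hji) z)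
    (S : ∀ i, Set (Z i)) (hS : ∀ i, IsClosed (S i)) (hne : ∀ i, (S i).Nonempty)
    (hmaps : ∀ i j h, Set.MapsTo (f i j h) (S i) (S j)) :
    ∃ z : InvLim Z f, ∀ i, z.1 i ∈ S i := by
  classical
  let T : I → Set (∀ i, Z i) := fun i => {p | p i ∈ S i ∧ ∀ j (h : j ≤ i), f i j h (p i) = p j}
  have hclosed : ∀ i, IsClosed (T i) := fun i =>
    ((hS i).preimage (continuous_apply i)).inter (isClosed_setOf_forall_le_map_eq hf i)
  have hanti : ∀ i j, j ≤ i → T i ⊆ T j := fun i j h p hp => by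
    refine ⟨hp.2 j h ▸ hmaps i j h hp.1, fun k hk => ?_⟩
    rw [← hp.2 j h, hfcomp, hp.2]
  have hT : (⋂ i, T i).Nonempty := by
    refine IsCompact.nonempty_iInter_of_directed_nonempty_isCompact_isClosed T ?_ ?_
      (fun i => (hclosed i).isCompact) hclosed
    · intro i j
      obtain ⟨k, hik, hjk⟩ := exists_ge_ge i j
      exact ⟨k, hanti k i hik, hanti k j hjk⟩
    · intro i
      obtain ⟨z, hz⟩ := hne i
      refine ⟨fun j => if h : j ≤ i then f i j h z else (hne j).some, ?_, fun j h => ?_⟩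
      · simpa [hfid] using hz
      · simp [h, hfid]
  obtain ⟨p, hp⟩ := hT
  rw [Set.mem_iInter] at hp
  exact ⟨⟨p, fun i j h => (hp i).2 j h⟩, fun i => (hp i).1⟩

end InvLim

section Comparison

variable {I : Type*} [Preorder I] {X Y : I → Type*}
  {f : ∀ i j : I, j ≤ i → X i → X j} {g : ∀ i j : I, j ≤ i → Y i → Y j}

/-- The comparison map `[t, x, y] ↦ ([t, x i, y i])ᵢ` from the join of the inverse limits to the
inverse limit of the joins. -/
def TopJoin.toInvLim (z : TopJoin (InvLim X f) (InvLim Y g)) :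
    InvLim (fun i => TopJoin (X i) (Y i)) (fun i j h => TopJoin.map (f i j h) (g i j h)) :=
  ⟨fun i => TopJoin.map (fun x => x.1 i) (fun y => y.1 i) z, fun i j h => by
    obtain ⟨t, x, y, rfl⟩ := joinMk_surjective z
    change joinMk t (f i j h (x.1 i)) (g i j h (y.1 i)) = joinMk t (x.1 j) (y.1 j)
    rw [x.2 i j h, y.2 i j h]⟩

theorem TopJoin.continuous_toInvLim [∀ i, TopologicalSpace (X i)]
    [∀ i, TopologicalSpace (Y i)] :
    Continuous (TopJoin.toInvLim (f := f) (g := g)) :=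
  Continuous.subtype_mk (continuous_pi fun i => TopJoin.continuous_map
    ((continuous_apply i).comp continuous_subtype_val)
    ((continuous_apply i).comp continuous_subtype_val)) _

theorem TopJoin.toInvLim_injective [Nonempty I] :
    Function.Injective (TopJoin.toInvLim (f := f) (g := g)) := by
  intro z z' h
  obtain ⟨t, x, y, rfl⟩ := joinMk_surjective z
  obtain ⟨t', x', y', rfl⟩ := joinMk_surjective z'
  have h' : ∀ i, t = t' ∧ (t ≠ 0 → x.1 i = x'.1 i) ∧ (t ≠ 1 → y.1 i = y'.1 i) :=
    fun i => joinMk_eq_joinMk_iff.1 (congrFun (congrArg Subtype.val h) i)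
  exact joinMk_eq_joinMk_iff.2 ⟨(h' (Classical.arbitrary I)).1,
    fun h0 => Subtype.ext (funext fun i => (h' i).2.1 h0),
    fun h1 => Subtype.ext (funext fun i => (h' i).2.2 h1)⟩

theorem TopJoin.toInvLim_surjective [IsDirected I (· ≤ ·)] [Nonempty I]
    [∀ i, TopologicalSpace (X i)] [∀ i, CompactSpace (X i)] [∀ i, T2Space (X i)]
    [∀ i, TopologicalSpace (Y i)] [∀ i, CompactSpace (Y i)] [∀ i, T2Space (Y i)]
    (hfc : ∀ i j h, Continuous (f i j h)) (hgc : ∀ i j h, Continuous (g i j h))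
    (hfid : ∀ i, f i i le_rfl = id) (hgid : ∀ i, g i i le_rfl = id)
    (hfcomp : ∀ (i j k : I) (hji : j ≤ i) (hkj : k ≤ j),
      f j k hkj ∘ f i j hji = f i k (hkj.trans hji))
    (hgcomp : ∀ (i j k : I) (hji : j ≤ i) (hkj : k ≤ j),
      g j k hkj ∘ g i j hji = g i k (hkj.trans hji)) :
    Function.Surjective (TopJoin.toInvLim (f := f) (g := g)) := by
  intro w
  obtain ⟨p, hp⟩ := InvLim.exists_mem_of_isClosed
    (Z := fun i => unitInterval × X i × Y i)
    (f := fun i j h p => (p.1, f i j h p.2.1, g i j h p.2.2))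
    (fun i j h => by have := hfc i j h; have := hgc i j h; fun_prop)
    (fun i z => by simp [hfid, hgid])
    (fun i j k hji hkj z => by simp [← hfcomp i j k hji hkj, ← hgcomp i j k hji hkj])
    (fun i => {p | joinMk p.1 p.2.1 p.2.2 = w.1 i})
    (fun i => isClosed_eq continuous_joinMk continuous_const)
    (fun i => by
      obtain ⟨t, x, y, h⟩ := joinMk_surjective (w.1 i)
      exact ⟨(t, x, y), h⟩)
    (fun i j h p hp => by
      rw [Set.mem_ofPred_eq] at hp ⊢
      rw [← w.2 i j h, ← hp]
      rfl)
  have hconst : ∀ i j, (p.1 i).1 = (p.1 j).1 := fun i j => by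
    obtain ⟨k, hik, hjk⟩ := exists_ge_ge i j
    exact (congrArg Prod.fst (p.2 k i hik)).symm.trans (congrArg Prod.fst (p.2 k j hjk))
  let i₀ := Classical.arbitrary I
  refine ⟨joinMk (p.1 i₀).1
    ⟨fun i => (p.1 i).2.1, fun i j h => congrArg (fun q => q.2.1) (p.2 i j h)⟩
    ⟨fun i => (p.1 i).2.2, fun i j h => congrArg (fun q => q.2.2) (p.2 i j h)⟩,
    Subtype.ext (funext fun i => ?_)⟩
  change joinMk (p.1 i₀).1 (p.1 i).2.1 (p.1 i).2.2 = w.1 i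
  rw [hconst i₀ i]
  exact hp i

end Comparison

theorem stmt_0 {I : Type*} [Preorder I] [IsDirected I (· ≤ ·)] [Nonempty I]
    (X Y : I → Type*)
    [∀ i, TopologicalSpace (X i)] [∀ i, CompactSpace (X i)] [∀ i, T2Space (X i)]
    [∀ i, TopologicalSpace (Y i)] [∀ i, CompactSpace (Y i)] [∀ i, T2Space (Y i)]
    (f : ∀ i j : I, j ≤ i → X i → X j) (g : ∀ i j : I, j ≤ i → Y i → Y j)
    (hfc : ∀ i j h, Continuous (f i j h)) (hgc : ∀ i j h, Continuous (g i j h))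
    (hfid : ∀ i, f i i le_rfl = id) (hgid : ∀ i, g i i le_rfl = id)
    (hfcomp : ∀ (i j k : I) (hji : j ≤ i) (hkj : k ≤ j),
      f j k hkj ∘ f i j hji = f i k (hkj.trans hji))
    (hgcomp : ∀ (i j k : I) (hji : j ≤ i) (hkj : k ≤ j),
      g j k hkj ∘ g i j hji = g i k (hkj.trans hji))
    {G : Type*} [Group G]
    (σ : G → ∀ i, X i → X i) (ρ : G → ∀ i, Y i → Y i)
    (hσc : ∀ s i, Continuous (σ s i)) (hρc : ∀ s i, Continuous (ρ s i))
    (hσ1 : ∀ i x, σ 1 i x = x) (hρ1 : ∀ i y, ρ 1 i y = y)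
    (hσm : ∀ s t i x, σ (s * t) i x = σ s i (σ t i x))
    (hρm : ∀ s t i y, ρ (s * t) i y = ρ s i (ρ t i y))
    (hσeq : ∀ (i j : I) (h : j ≤ i) (s : G) (x : X i), f i j h (σ s i x) = σ s j (f i j h x))
    (hρeq : ∀ (i j : I) (h : j ≤ i) (s : G) (y : Y i), g i j h (ρ s i y) = ρ s j (g i j h y)) :
    -- the joins form again an inverse system of compact Hausdorff spaces:
    (∀ i, CompactSpace (TopJoin (X i) (Y i))) ∧
    (∀ i, T2Space (TopJoin (X i) (Y i))) ∧
    (∀ i j h, Continuous (TopJoin.map (f i j h) (g i j h))) ∧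
    (∀ i, TopJoin.map (f i i le_rfl) (g i i le_rfl) = id) ∧
    (∀ (i j k : I) (hji : j ≤ i) (hkj : k ≤ j),
      TopJoin.map (f j k hkj) (g j k hkj) ∘ TopJoin.map (f i j hji) (g i j hji) =
        TopJoin.map (f i k (hkj.trans hji)) (g i k (hkj.trans hji))) ∧
    -- Θ is a well-defined homeomorphism with the given formula, and is G-equivariant:
    ∃ Θ : TopJoin (InvLim X f) (InvLim Y g) ≃ₜ
        InvLim (fun i => TopJoin (X i) (Y i)) (fun i j h => TopJoin.map (f i j h) (g i j h)),
      (∀ (t : unitInterval) (x : InvLim X f) (y : InvLim Y g) (i : I),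
        (Θ (joinMk t x y)).1 i = joinMk t (x.1 i) (y.1 i)) ∧
      (∀ (s : G) (t : unitInterval) (x x' : InvLim X f) (y y' : InvLim Y g),
        (∀ i, x'.1 i = σ s i (x.1 i)) → (∀ i, y'.1 i = ρ s i (y.1 i)) →
        ∀ i, (Θ (joinMk t x' y')).1 i =
          TopJoin.map (σ s i) (ρ s i) ((Θ (joinMk t x y)).1 i)) := by
  have := InvLim.compactSpace hfc
  have := InvLim.compactSpace hgc
  refine ⟨fun i => inferInstance, fun i => inferInstance,
    fun i j h => TopJoin.continuous_map (hfc i j h) (hgc i j h),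
    fun i => by rw [hfid, hgid, TopJoin.map_id_id],
    fun i j k hji hkj => by rw [TopJoin.map_comp_map, hfcomp, hgcomp],
    Continuous.homeoOfEquivCompactToT2
      (f := Equiv.ofBijective TopJoin.toInvLim ⟨TopJoin.toInvLim_injective,
        TopJoin.toInvLim_surjective hfc hgc hfid hgid hfcomp hgcomp⟩)
      TopJoin.continuous_toInvLim,
    fun t x y i => rfl, fun s t x x' y y' hx hy i => ?_⟩
  change joinMk t (x'.1 i) (y'.1 i) = joinMk t (σ s i (x.1 i)) (ρ s i (y.1 i))
  rw [hx, hy]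
end

section
/- Let G be a finitely generated abelian group, D a finite-dimensional C*-algebra, and α : G → Aut(D) an action of G on D by ⋆-automorphisms. Then there exists a finite-index subgroup H of G which is free as an abelian group (equivalently, torsion-free) such that the restricted action α|_H : H → Aut(D) is unitary: there is a group homomorphism w : H → U(D) into the unitary group of D with α_t(a) = w_t a w_t* for all a ∈ D and t ∈ H. -/
open MeasureTheory

section CompactUnitary

variable {A : Type*} [CStarAlgebra A]

theorem norm_coe_unitary_le_one (u : unitary A) : ‖(u : A)‖ ≤ 1 := by
  cases subsingleton_or_nontrivial A
  · simp [Subsingleton.elim (u : A) 0]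
  · exact (CStarRing.norm_coe_unitary u).le

theorem compactSpace_unitary [FiniteDimensional ℂ A] : CompactSpace (unitary A) := by
  have : ProperSpace A := FiniteDimensional.proper ℂ A
  refine isCompact_iff_compactSpace.mp (Metric.isCompact_of_isClosed_isBounded isClosed_unitary ?_)
  refine (Metric.isBounded_closedBall (x := (0 : A)) (r := 1)).subset fun u hu => ?_
  simpa using norm_coe_unitary_le_one ⟨u, hu⟩

theorem StarAlgEquiv.continuous_of_cstarAlgebra (α : A ≃⋆ₐ[ℂ] A) : Continuous α :=
  (StarAlgEquiv.isometry α).continuous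

/-- The average of `α u * u⋆` over the unitary group. -/
noncomputable def unitaryAverage [MeasurableSpace (unitary A)] (μ : Measure (unitary A))
    (α : A ≃⋆ₐ[ℂ] A) : A :=
  ∫ u : unitary A, α u * star (u : A) ∂μ

theorem continuous_apply_mul_star (α : A ≃⋆ₐ[ℂ] A) :
    Continuous fun u : unitary A => α u * star (u : A) :=
  (α.continuous_of_cstarAlgebra.comp continuous_subtype_val).mul continuous_subtype_val.star

variable [FiniteDimensional ℂ A] [MeasurableSpace (unitary A)] [BorelSpace (unitary A)]
  (μ : Measure (unitary A)) [μ.IsHaarMeasure]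

theorem integrable_of_continuous_unitary {f : unitary A → A} (hf : Continuous f) :
    Integrable f μ :=
  have := compactSpace_unitary (A := A)
  hf.integrable_of_hasCompactSupport (.of_compactSpace f)

theorem apply_mul_unitaryAverage (α : A ≃⋆ₐ[ℂ] A) (a : A) :
    α a * unitaryAverage μ α = unitaryAverage μ α * a := by
  have hint := integrable_of_continuous_unitary μ (continuous_apply_mul_star α)
  have hv (v : unitary A) : α v * unitaryAverage μ α = unitaryAverage μ α * v := by
    have h : α v * unitaryAverage μ α * star (v : A) = unitaryAverage μ α := by
      unfold unitaryAverage
      rw [← integral_const_mul_of_integrable hint,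
        ← integral_mul_const_of_integrable (hint.const_mul _),
        ← integral_mul_left_eq_self (fun u : unitary A => α u * star (u : A)) v]
      simp [mul_assoc]
    conv_rhs => rw [← h]
    simp [mul_assoc]
  have ha : a ∈ Submodule.span ℂ (unitary A : Set A) := by simp [CStarAlgebra.span_unitary]
  induction ha using Submodule.span_induction with
  | mem v h => exact hv ⟨v, h⟩
  | zero => simp
  | add x y _ _ hx hy => rw [map_add, add_mul, mul_add, hx, hy]
  | smul c x _ hx => rw [map_smul, smul_mul_assoc, mul_smul_comm, hx]

variable [IsProbabilityMeasure μ]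

theorem apply_unitaryAverage_of_commute {α β : A ≃⋆ₐ[ℂ] A} (h : ∀ a, β (α a) = α (β a)) :
    β (unitaryAverage μ α) = unitaryAverage μ α := by
  have := compactSpace_unitary (A := A)
  let S (γ : A ≃⋆ₐ[ℂ] A) : A ≃⋆* A := { γ with map_mul' := map_mul γ, map_star' := map_star γ }
  have hβ (γ : A ≃⋆ₐ[ℂ] A) : Continuous (Unitary.mapEquiv (S γ)) :=
    (γ.continuous_of_cstarAlgebra.comp continuous_subtype_val).subtype_mk _
  let e : unitary A ≃* unitary A := (Unitary.mapEquiv (S β)).toMulEquiv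
  have hec : Continuous e := hβ β
  have he (u) : (e u : A) = β u := rfl
  have hHaar : (μ.map e).IsHaarMeasure := e.isHaarMeasure_map μ hec (hβ β.symm)
  have hmap : (μ.map e) = μ := by
    have : IsProbabilityMeasure (μ.map e) :=
      Measure.isProbabilityMeasure_map hec.measurable.aemeasurable
    exact Measure.isHaarMeasure_eq_of_isProbabilityMeasure _ _
  let B : A →L[ℂ] A := ⟨β.toAlgEquiv.toLinearMap, β.continuous_of_cstarAlgebra⟩
  have hB (a) : B a = β a := rfl
  unfold unitaryAverage
  conv_rhs => rw [← hmap]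
  rw [integral_map hec.measurable.aemeasurable
      (integrable_of_continuous_unitary (μ.map e) (continuous_apply_mul_star α)).aestronglyMeasurable,
    ← hB, ← B.integral_comp_comm
      (integrable_of_continuous_unitary μ (continuous_apply_mul_star α))]
  simp [hB, h, he, map_star]

theorem isUnit_unitaryAverage {α : A ≃⋆ₐ[ℂ] A} {c : ℝ} (hc : c < 1)
    (h : ∀ a, ‖α a - a‖ ≤ c * ‖a‖) : IsUnit (unitaryAverage μ α) := by
  cases subsingleton_or_nontrivial A
  · exact isUnit_of_subsingleton _
  have h1 : ‖1 - unitaryAverage μ α‖ < 1 := by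
    have : unitaryAverage μ α - 1 = ∫ u : unitary A, (α u * star (u : A) - 1) ∂μ := by
      rw [integral_sub (integrable_of_continuous_unitary _ (continuous_apply_mul_star α))
        (integrable_const _)]
      simp [unitaryAverage]
    rw [norm_sub_rev, this]
    refine (norm_integral_le_of_norm_le_const (C := c) (.of_forall fun u => ?_)).trans_lt (by simpa)
    have : α u * star (u : A) - 1 = (α u - u) * star (u : A) := by simp [sub_mul]
    rw [this]
    calc _ ≤ ‖α u - u‖ * ‖star (u : A)‖ := norm_mul_le _ _
      _ ≤ _ := by simpa using h u
  simpa using (Units.oneSub _ h1).isUnit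

end CompactUnitary

section Implement

variable {A : Type*} [CStarAlgebra A]

/-- If `w` is an invertible intertwiner between the identity and a ⋆-automorphism, then the
unitary part of `w` also intertwines, and it differs from `w` by a central element. -/
theorem exists_unitary_of_intertwiner {α : A ≃⋆ₐ[ℂ] A} {w : A} (hw : IsUnit w)
    (h : ∀ a, α a * w = w * a) :
    ∃ u : unitary A, (∀ a, α a = u * a * star (u : A)) ∧
      ∃ r : A, (∀ a, Commute r a) ∧ (u : A) = w * r := by
  let _ := CStarAlgebra.spectralOrder A
  let _ := CStarAlgebra.spectralOrderedRing A
  have hstar (a : A) : star w * α a = a * star w := by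
    simpa [map_star] using congrArg star (h (star a))
  have hcomm (a : A) : Commute (star w * w) a := by
    rw [Commute, SemiconjBy, mul_assoc, ← h, ← mul_assoc, hstar, mul_assoc]
  have hp : IsStrictlyPositive (star w * w) :=
    IsStrictlyPositive.iff_of_unital.mpr ⟨star_mul_self_nonneg w, hw.star.mul hw⟩
  set p := star w * w
  set r : A := p ^ (-(1 / 2) : ℝ) with hr
  have hrc (a : A) : Commute r a := (hcomm a).cfc_nnreal _
  have hrs : star r = r := (IsSelfAdjoint.of_nonneg CFC.rpow_nonneg)
  have hrpr : r * p * r = 1 := by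
    have h1 : p * (r * r) = 1 := by
      rw [hr, ← CFC.rpow_add hp.isUnit]
      conv_lhs => enter [1]; rw [← CFC.rpow_one p hp.nonneg]
      rw [← CFC.rpow_add hp.isUnit]
      norm_num [CFC.rpow_zero p hp.nonneg]
    rw [(hrc p).eq, mul_assoc, h1]
  have hru : IsUnit r := (hrc 1).isUnit_mul_iff.mp (by simpa using hp.isUnit.cfcRpow _) |>.1
  have hu1 : star (w * r) * (w * r) = 1 := by
    rw [star_mul, hrs, ← hrpr]; simp [p, mul_assoc]
  have hu2 : (w * r) * star (w * r) = 1 := by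
    obtain ⟨v, hv⟩ := hw.mul hru
    rw [← hv] at hu1 ⊢
    rw [Units.eq_inv_of_mul_eq_one_right hu1, Units.mul_inv]
  refine ⟨⟨w * r, hu1, hu2⟩, fun a => ?_, r, hrc, rfl⟩
  have : w * r * a = α a * (w * r) := by
    rw [mul_assoc, (hrc a).eq, ← mul_assoc, ← h, mul_assoc]
  change α a = w * r * a * star (w * r)
  rw [this, mul_assoc, hu2, mul_one]

/-- Pairwise commuting ⋆-automorphisms of a finite-dimensional C⋆-algebra that are close to the
identity are implemented by pairwise commuting unitaries. -/
theorem exists_commuting_unitaries [FiniteDimensional ℂ A] {ι : Type*} {α : ι → A ≃⋆ₐ[ℂ] A}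
    (hcomm : ∀ i j, Commute (α i) (α j)) {c : ℝ} (hc : c < 1)
    (h : ∀ i a, ‖α i a - a‖ ≤ c * ‖a‖) :
    ∃ u : ι → unitary A, (∀ i j, Commute (u i) (u j)) ∧
      ∀ i, α i = Unitary.conjStarAlgAut ℂ A (u i) := by
  have := compactSpace_unitary (A := A)
  let _ : MeasurableSpace (unitary A) := borel _
  have : BorelSpace (unitary A) := ⟨rfl⟩
  let μ : Measure (unitary A) := Measure.haarMeasure ⊤
  have : IsProbabilityMeasure μ := ⟨Measure.haarMeasure_self (K₀ := ⊤)⟩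
  choose u hu r hr hur using fun i =>
    exists_unitary_of_intertwiner (isUnit_unitaryAverage μ hc (h i))
      (apply_mul_unitaryAverage μ (α i))
  refine ⟨u, fun i j => Subtype.ext ?_, fun i => StarAlgEquiv.ext fun a => ?_⟩
  · have hw : Commute (unitaryAverage μ (α i)) (unitaryAverage μ (α j)) := by
      have := apply_mul_unitaryAverage μ (α i) (unitaryAverage μ (α j))
      rw [apply_unitaryAverage_of_commute μ fun a => DFunLike.congr_fun (hcomm i j).eq a] at this
      exact this.symm
    change Commute (u i : A) (u j)
    rw [hur, hur]
    exact (hw.mul_right (hr j _).symm).mul_left (hr i _)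
  · simpa using hu i a

end Implement

section Recurrence

variable {A : Type*} [CStarAlgebra A] [FiniteDimensional ℂ A]

/-- Finitely many ⋆-automorphisms of a finite-dimensional C⋆-algebra have simultaneous recurrence:
a common positive power of them is close to the identity. -/
theorem exists_pow_near_one {ι : Type*} [Fintype ι] (α : ι → A ≃⋆ₐ[ℂ] A) {ε : ℝ} (hε : 0 < ε) :
    ∃ n : ℕ, n ≠ 0 ∧ ∀ i a, ‖(α i ^ n) a - a‖ ≤ ε * ‖a‖ := by
  let L (β : A ≃⋆ₐ[ℂ] A) : A →L[ℂ] A := ⟨β.toAlgEquiv.toLinearMap, β.continuous_of_cstarAlgebra⟩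
  have hL (β : A ≃⋆ₐ[ℂ] A) (a) : L β a = β a := rfl
  have hLn (β : A ≃⋆ₐ[ℂ] A) : ‖L β‖ ≤ 1 :=
    ContinuousLinearMap.opNorm_le_bound _ zero_le_one fun a => by
      rw [hL, StarAlgEquiv.norm_map, one_mul]
  have : ProperSpace (ι → A →L[ℂ] A) := FiniteDimensional.proper ℂ _
  obtain ⟨f, -, φ, hφ, hlim⟩ := tendsto_subseq_of_bounded
    (Metric.isBounded_closedBall (x := (0 : ι → A →L[ℂ] A)) (r := 1))
    (x := fun n i => L (α i ^ n)) fun n => by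
      rw [mem_closedBall_zero_iff, pi_norm_le_iff_of_nonneg zero_le_one]
      exact fun i => hLn _
  obtain ⟨N, hN⟩ := Metric.cauchySeq_iff'.mp hlim.cauchySeq ε hε
  have hlt : φ N < φ (N + 1) := hφ N.lt_succ_self
  refine ⟨φ (N + 1) - φ N, by omega, fun i a => ?_⟩
  have h1 : ‖L (α i ^ φ (N + 1)) - L (α i ^ φ N)‖ ≤ ε := by
    rw [← dist_eq_norm]
    exact (dist_le_pi_dist _ _ i).trans (hN _ N.le_succ).le
  have h2 := (L (α i ^ φ (N + 1)) - L (α i ^ φ N)).le_of_opNorm_le h1 a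
  rw [sub_apply, hL, hL, ← Nat.add_sub_cancel' hlt.le, pow_add,
    StarAlgEquiv.mul_apply, ← map_sub, StarAlgEquiv.norm_map] at h2
  simpa using h2

end Recurrence

theorem Subgroup.finiteIndex_of_forall_exists_pow_mem {G : Type*} [CommGroup G] [Group.FG G]
    (H : Subgroup G) (h : ∀ g, ∃ n : ℕ, 0 < n ∧ g ^ n ∈ H) : H.FiniteIndex := by
  have : Finite (G ⧸ H) := CommGroup.finite_of_fg_isMulTorsion (G ⧸ H) fun x => by
    obtain ⟨g, rfl⟩ := QuotientGroup.mk_surjective x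
    obtain ⟨n, hn, hg⟩ := h g
    exact isOfFinOrder_iff_pow_eq_one.mpr ⟨n, hn, (QuotientGroup.eq_one_iff _).mpr hg⟩
  exact Subgroup.finiteIndex_of_finite_quotient

theorem exists_free_exponent {G : Type*} [CommGroup G] [Group.FG G] :
    ∃ (ι : Type) (_ : Fintype ι) (f : (ι → Multiplicative ℤ) →* G) (m : ℕ),
      Function.Injective f ∧ m ≠ 0 ∧ ∀ g : G, ∃ x, f x = g ^ m := by
  obtain ⟨κ, ι, _, _, p, hp, e, ⟨E⟩⟩ := CommGroup.equiv_free_prod_prod_multiplicative_zmod G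
  have (i : κ) : NeZero (p i ^ e i) := ⟨pow_ne_zero _ (hp i).ne_zero⟩
  let T := (i : κ) → Multiplicative (ZMod (p i ^ e i))
  have : ∀ i : κ, Finite (Multiplicative (ZMod (p i ^ e i))) := fun i =>
    inferInstanceAs (Finite (ZMod (p i ^ e i)))
  refine ⟨ι, ‹_›, E.symm.toMonoidHom.comp (MonoidHom.inl _ T), Nat.card T, ?_, Nat.card_pos.ne',
    fun g => ⟨((E g) ^ Nat.card T).1, ?_⟩⟩
  · exact E.symm.injective.comp (Prod.mk_left_injective 1)
  · rw [MonoidHom.comp_apply]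
    change E.symm _ = _
    rw [MulEquiv.symm_apply_eq, map_pow]
    ext1
    · rfl
    · simp [T]

/-- A commuting family of group elements defines a homomorphism from the free abelian group. -/
noncomputable def freeAbelianHom {ι M : Type*} [Fintype ι] [Group M] (u : ι → M)
    (hu : ∀ i j, Commute (u i) (u j)) : (ι → Multiplicative ℤ) →* M :=
  MonoidHom.noncommPiCoprod (fun i => zpowersHom M (u i)) fun i j _ x y => by
    simpa using (hu i j).zpow_zpow x.toAdd y.toAdd

theorem freeAbelianHom_mulSingle {ι M : Type*} [Fintype ι] [DecidableEq ι] [Group M] (u : ι → M)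
    (hu : ∀ i j, Commute (u i) (u j)) (i : ι) :
    freeAbelianHom u hu (Pi.mulSingle i (Multiplicative.ofAdd 1)) = u i :=
  (MonoidHom.noncommPiCoprod_mulSingle (fun i => zpowersHom M (u i)) i _).trans (by simp)

/-- Let `G` be a finitely generated abelian group acting on a finite-dimensional
C*-algebra `D` by ⋆-automorphisms. Then there is a finite-index subgroup `H` of `G`,
free as an abelian group (equivalently, torsion-free), on which the action is unitarily
implemented by a group homomorphism `w : H → U(D)`. -/
theorem stmt_6 {G D : Type*} [CommGroup G] (hfg : Group.FG G)
    [NormedRing D] [StarRing D] [CStarRing D] [NormedAlgebra ℂ D] [StarModule ℂ D]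
    [CompleteSpace D] [FiniteDimensional ℂ D]
    (α : G → D ≃⋆ₐ[ℂ] D)
    (hα1 : ∀ a : D, α 1 a = a)
    (hαm : ∀ (g h : G) (a : D), α (g * h) a = α g (α h a)) :
    ∃ H : Subgroup G, H.FiniteIndex ∧
      (∀ g ∈ H, ∀ n : ℕ, n ≠ 0 → g ^ n = 1 → g = 1) ∧
      ∃ w : H →* unitary D,
        ∀ (t : H) (a : D), α (t : G) a = (w t : D) * a * star ((w t : D)) := by
  classical
  let _ : CStarAlgebra D := {}
  obtain ⟨ι, _, f, m, hf, hm, hfm⟩ := exists_free_exponent (G := G)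
  let A : G →* (D ≃⋆ₐ[ℂ] D) :=
    { toFun := α
      map_one' := StarAlgEquiv.ext hα1
      map_mul' := fun g h => StarAlgEquiv.ext (hαm g h) }
  let b (i : ι) : ι → Multiplicative ℤ := Pi.mulSingle i (Multiplicative.ofAdd 1)
  obtain ⟨n, hn, hnear⟩ := exists_pow_near_one (fun i => A (f (b i))) (ε := 1 / 2) (by norm_num)
  obtain ⟨u, hu, hαu⟩ := exists_commuting_unitaries (α := fun i => A (f (b i)) ^ n)
    (fun i j => ((Commute.all (b i) (b j)).map (A.comp f)).pow_pow n n) (by norm_num) hnear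
  let F : (ι → Multiplicative ℤ) →* G := f.comp (powMonoidHom n)
  have hF : Function.Injective F := hf.comp (pow_left_injective hn)
  let e := MonoidHom.ofInjective hF
  have hAF : A.comp F = (Unitary.conjStarAlgAut ℂ D).comp (freeAbelianHom u hu) := by
    refine MonoidHom.noncommPiCoprodEquiv.symm.injective <| Subtype.ext <| funext fun i =>
      MonoidHom.ext_mint ?_
    have hp : (A.comp F) (b i) = Unitary.conjStarAlgAut ℂ D (u i) := by simp [F, ← hαu]
    change (A.comp F) (b i) = Unitary.conjStarAlgAut ℂ D (freeAbelianHom u hu (b i))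
    rw [hp, freeAbelianHom_mulSingle]
  refine ⟨F.range, ?_, ?_, (freeAbelianHom u hu).comp e.symm.toMonoidHom, fun t a => ?_⟩
  · refine Subgroup.finiteIndex_of_forall_exists_pow_mem _ fun g => ?_
    obtain ⟨x, hx⟩ := hfm g
    exact ⟨m * n, by positivity, x, by simp [F, hx, pow_mul]⟩
  · rintro _ ⟨x, rfl⟩ k hk hx
    rw [← map_pow, ← map_one F, hF.eq_iff] at hx
    rw [pow_left_injective hk (hx.trans (one_pow k).symm), map_one]
  · obtain ⟨x, rfl⟩ := e.surjective t
    have := DFunLike.congr_fun (DFunLike.congr_fun hAF x) a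
    simp only [MonoidHom.comp_apply, MulEquiv.coe_toMonoidHom, e.symm_apply_apply]
    exact this
end

section
/- Let G be a finitely generated abelian group, A a C*-algebra, α : G → Aut(A) an action by ⋆-automorphisms, and (R_n)_{n ∈ ℕ} an increasing sequence of finite-dimensional ⋆-subalgebras of A, each of which is invariant under α_g for every g ∈ G; write α^{(n)} : G → Aut(R_n) for the induced action. Then there exists a decreasing sequence (H_k)_{k ∈ ℕ} of finite-index subgroups of G, each free as an abelian group, which is a dominating regular approximation of G, and such that for every n ∈ ℕ and every k ≥ n the restricted action α^{(n)}|_{H_k} : H_k → Aut(R_n) is unitary, i.e., there is a group homomorphism w : H_k → U(R_n) into the unitary group of R_n with α_t(x) = w_t x w_t* for all x ∈ R_n and t ∈ H_k. -/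
/-- A finite-dimensional C⋆-algebra has a two-sided identity. -/
theorem exists_unit_of_finiteDimensional (B : Type*) [NonUnitalCStarAlgebra B]
    [FiniteDimensional ℂ B] : ∃ e : B, ∀ x, e * x = x ∧ x * e = x := by
  let _ := CStarAlgebra.spectralOrder B
  have := CStarAlgebra.spectralOrderedRing B
  have : ProperSpace B := FiniteDimensional.proper ℂ B
  have hl := CStarAlgebra.increasingApproximateUnit B
  obtain ⟨e, -, he⟩ := (isCompact_closedBall (0 : B) 1).exists_clusterPt
    (f := CStarAlgebra.approximateUnit B) (by
      rw [Filter.le_principal_iff]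
      filter_upwards [hl.eventually_norm] with x hx
      simpa using hx)
  have : (nhds e ⊓ CStarAlgebra.approximateUnit B).NeBot := he
  refine ⟨e, fun x => ⟨?_, ?_⟩⟩
  · exact tendsto_nhds_unique
      ((continuous_mul_const x).continuousAt.tendsto.mono_left inf_le_left)
      ((hl.tendsto_mul_right x).mono_left inf_le_right)
  · exact tendsto_nhds_unique
      ((continuous_const_mul x).continuousAt.tendsto.mono_left inf_le_left)
      ((hl.tendsto_mul_left x).mono_left inf_le_right)

/-- A non-unital C⋆-algebra with a two-sided identity, as a unital C⋆-algebra. -/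
@[reducible]
noncomputable def CStarAlgebra.ofUnit {B : Type*} [h : NonUnitalCStarAlgebra B] (e : B)
    (he : ∀ x, e * x = x ∧ x * e = x) : CStarAlgebra B :=
  letI : Ring B :=
    { (inferInstance : NonUnitalRing B) with
      one := e
      one_mul := fun x => (he x).1
      mul_one := fun x => (he x).2 }
  letI : NormedRing B := { h.toNonUnitalNormedRing, (inferInstance : Ring B) with }
  letI : Algebra ℂ B := Algebra.ofModule (fun r x y => smul_mul_assoc r x y)
    (fun r x y => mul_smul_comm r x y)
  letI : NormedAlgebra ℂ B :=
    { (inferInstance : Algebra ℂ B) with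
      norm_smul_le := fun r x => norm_smul_le r x }
  { h with
    toNormedRing := inferInstance
    toNormedAlgebra := inferInstance }

/-- A finite-dimensional unital C⋆-algebra is semisimple. -/
theorem CStarAlgebra.isSemisimpleRing (B : Type*) [CStarAlgebra B] [FiniteDimensional ℂ B] :
    IsSemisimpleRing B := by
  have := IsArtinianRing.of_finite ℂ B
  rw [IsArtinianRing.isSemisimpleRing_iff_jacobson, eq_bot_iff]
  intro x hx
  obtain ⟨n, hn⟩ := IsArtinianRing.isNilpotent_jacobson_bot (R := B)
  rw [Ideal.jacobson_bot] at hn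
  have h1 : (star x * x) ^ (2 ^ n) = 0 := by
    have h2 : (star x * x) ^ n ∈ Ring.jacobson B ^ n :=
      Ideal.pow_mem_pow (Ideal.mul_mem_left _ _ hx) n
    rw [hn] at h2
    have h3 : (star x * x) ^ n = 0 := by simpa using h2
    exact pow_eq_zero_of_le Nat.lt_two_pow_self.le h3
  have h4 := (IsSelfAdjoint.star_mul_self x).nnnorm_pow_two_pow n
  rw [h1, nnnorm_zero] at h4
  have h5 := eq_zero_of_pow_eq_zero h4.symm
  rw [nnnorm_eq_zero, CStarRing.star_mul_self_eq_zero_iff] at h5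
  simpa using h5

/-- Skolem–Noether for complex matrix algebras. -/
theorem Matrix.exists_units_conj {n : Type*} [Fintype n] [DecidableEq n]
    (φ : Matrix n n ℂ ≃ₐ[ℂ] Matrix n n ℂ) :
    ∃ u : (Matrix n n ℂ)ˣ, ∀ x, φ x = u * x * (u⁻¹ : (Matrix n n ℂ)ˣ) := by
  obtain ⟨T, hT⟩ := AlgEquiv.eq_linearEquivConjAlgEquiv
    ((Matrix.toLinAlgEquiv' (R := ℂ) (n := n)).symm.trans (φ.trans Matrix.toLinAlgEquiv'))
  let U := (LinearMap.GeneralLinearGroup.generalLinearEquiv ℂ (n → ℂ)).symm T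
  refine ⟨Units.map (LinearMap.toMatrixAlgEquiv' (R := ℂ) (n := n) : _ →* _) U, fun x => ?_⟩
  have := DFunLike.congr_fun hT (Matrix.toLinAlgEquiv' x)
  apply (Matrix.toLinAlgEquiv' (R := ℂ) (n := n)).injective
  simp only [AlgEquiv.trans_apply, AlgEquiv.symm_apply_apply] at this
  rw [this, ← map_inv]
  simp only [map_mul, Units.coe_map, MonoidHom.coe_coe]
  erw [Matrix.toLinAlgEquiv'_toMatrixAlgEquiv', Matrix.toLinAlgEquiv'_toMatrixAlgEquiv']
  rfl

theorem Matrix.pow_card_eq_one_of_mem_center {n : Type*} [Fintype n] [DecidableEq n]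
    (x y : (Matrix n n ℂ)ˣ)
    (h : ∀ z : Matrix n n ℂ,
      Commute ((x * y * x⁻¹ * y⁻¹ : (Matrix n n ℂ)ˣ) : Matrix n n ℂ) z) :
    (x * y * x⁻¹ * y⁻¹) ^ Fintype.card n = 1 := by
  obtain ⟨r, hr⟩ : ((x * y * x⁻¹ * y⁻¹ : (Matrix n n ℂ)ˣ) : Matrix n n ℂ) ∈
      Set.range (Matrix.scalar n) := by
    rw [Matrix.mem_range_scalar_iff_commute_single']
    intro i j
    exact (h _).symm
  have h1 : Matrix.det ((x * y * x⁻¹ * y⁻¹ : (Matrix n n ℂ)ˣ) : Matrix n n ℂ) = 1 := by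
    have : Units.map (Matrix.detMonoidHom (R := ℂ) (n := n)) (x * y * x⁻¹ * y⁻¹) = 1 := by
      simp
    exact congrArg Units.val this
  rw [← hr] at h1
  ext1
  rw [Units.val_pow_eq_pow_val, ← hr, ← map_pow]
  simp at h1
  simp [h1]

theorem pi_matrix_exists_units_conj {ι : Type*} [DecidableEq ι] {d : ι → ℕ}
    (φ : (Π i, Matrix (Fin (d i)) (Fin (d i)) ℂ) ≃ₐ[ℂ] (Π i, Matrix (Fin (d i)) (Fin (d i)) ℂ))
    (hφ : ∀ i, φ (Pi.single i 1) = Pi.single i 1) :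
    ∃ u : (Π i, Matrix (Fin (d i)) (Fin (d i)) ℂ)ˣ, ∀ x,
      φ x = u * x * (u⁻¹ : (Π i, Matrix (Fin (d i)) (Fin (d i)) ℂ)ˣ) := by
  have key : ∀ i x, φ (Pi.single i (x i)) = Pi.single i (φ x i) := by
    intro i x
    have h1 : (Pi.single i (x i) : Π i, Matrix (Fin (d i)) (Fin (d i)) ℂ) = x * Pi.single i 1 := by
      funext j
      rcases eq_or_ne j i with rfl | hj <;> simp [*]
    have h2 : (Pi.single i (φ x i) : Π i, Matrix (Fin (d i)) (Fin (d i)) ℂ) =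
        φ x * Pi.single i 1 := by
      funext j
      rcases eq_or_ne j i with rfl | hj <;> simp [*]
    rw [h1, h2, map_mul, hφ]
  let ψ : ∀ i, Matrix (Fin (d i)) (Fin (d i)) ℂ →ₐ[ℂ] Matrix (Fin (d i)) (Fin (d i)) ℂ := fun i =>
    AlgHom.ofLinearMap
      ((LinearMap.proj i).comp (φ.toLinearMap.comp
        (LinearMap.single ℂ (fun i => Matrix (Fin (d i)) (Fin (d i)) ℂ) i)))
      (by simp [hφ])
      (fun x y => by
        simp [Pi.single_mul (α := fun i => Matrix (Fin (d i)) (Fin (d i)) ℂ)])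
  have hψ : ∀ i a, ψ i a = φ (Pi.single i a) i := fun i a => rfl
  have hψ2 : ∀ i x, φ x i = ψ i (x i) := fun i x => by rw [hψ, key]; simp
  have hinj : ∀ i, Function.Injective (ψ i) := by
    intro i
    rw [injective_iff_map_eq_zero]
    intro a ha
    have h3 := key i (Pi.single i a)
    rw [← hψ, ha] at h3
    simpa using h3
  have hbij : ∀ i, Function.Bijective (ψ i) := fun i =>
    ⟨hinj i, LinearMap.surjective_of_injective (f := (ψ i).toLinearMap) (hinj i)⟩
  choose u hu using fun i => Matrix.exists_units_conj (AlgEquiv.ofBijective (ψ i) (hbij i))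
  refine ⟨MulEquiv.piUnits.symm u, fun x => ?_⟩
  funext i
  rw [hψ2]
  exact hu i (x i)

theorem pi_matrix_pow_eq_one {ι : Type*} [Fintype ι] [DecidableEq ι] {d : ι → ℕ}
    (x y : (Π i, Matrix (Fin (d i)) (Fin (d i)) ℂ)ˣ)
    (h : ∀ z : Π i, Matrix (Fin (d i)) (Fin (d i)) ℂ,
      Commute ((x * y * x⁻¹ * y⁻¹ : (Π i, Matrix (Fin (d i)) (Fin (d i)) ℂ)ˣ) :
        Π i, Matrix (Fin (d i)) (Fin (d i)) ℂ) z) :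
    (x * y * x⁻¹ * y⁻¹) ^ (∏ i, d i) = 1 := by
  apply MulEquiv.piUnits.injective
  funext i
  obtain ⟨m, hm⟩ := Finset.dvd_prod_of_mem d (Finset.mem_univ i)
  have := Matrix.pow_card_eq_one_of_mem_center (MulEquiv.piUnits x i)
    (MulEquiv.piUnits y i) (fun z => by
      simpa [commute_iff_eq] using congrFun (h (Pi.single i z)) i)
  rw [Fintype.card_fin] at this
  simp only [map_pow, map_mul, map_inv, map_one, Pi.pow_apply, Pi.mul_apply, Pi.inv_apply,
    Pi.one_apply]
  rw [hm, pow_mul, this, one_pow]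

theorem pi_matrix_finite_central_idempotents {ι : Type*} [Fintype ι] [DecidableEq ι]
    {d : ι → ℕ} :
    {z : Π i, Matrix (Fin (d i)) (Fin (d i)) ℂ | IsIdempotentElem z ∧ ∀ x, Commute z x}.Finite := by
  refine (Set.finite_range (fun s : ι → Bool =>
    fun i => (if s i then (1 : Matrix (Fin (d i)) (Fin (d i)) ℂ) else 0))).subset ?_
  rintro z ⟨hz, hc⟩
  have : ∀ i, ∃ b : Bool, (if b then (1 : Matrix (Fin (d i)) (Fin (d i)) ℂ) else 0) = z i := by
    intro i
    obtain ⟨r, hr⟩ : z i ∈ Set.range (Matrix.scalar (Fin (d i))) := by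
      rw [Matrix.mem_range_scalar_iff_commute_single']
      intro a b
      simpa [commute_iff_eq] using (congrFun (hc (Pi.single i (Matrix.single a b 1))) i).symm
    have h2 : z i * z i = z i := congrFun hz i
    rcases isEmpty_or_nonempty (Fin (d i)) with h | h
    · exact ⟨true, Subsingleton.elim _ _⟩
    · rw [← hr, ← map_mul, Matrix.scalar_inj] at h2
      rcases IsIdempotentElem.iff_eq_zero_or_one.1 h2 with rfl | rfl
      · exact ⟨false, by simp [← hr]⟩
      · exact ⟨true, by simp [← hr]⟩
  choose b hb using this
  exact ⟨b, funext hb⟩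

/-- A ⋆-automorphism implemented by a unit is implemented by a unitary. -/
theorem exists_unitary_of_units {B : Type*} [CStarAlgebra B] (φ : B ≃⋆ₐ[ℂ] B) (u : Bˣ)
    (h : ∀ x, φ x = u * x * (u⁻¹ : Bˣ)) : ∃ v : unitary B, Unitary.conjStarAlgAut ℂ B v = φ := by
  let _ := CStarAlgebra.spectralOrder B
  have := CStarAlgebra.spectralOrderedRing B
  set z : B := star (u : B) * u with hz
  have hpos : IsStrictlyPositive z :=
    CStarAlgebra.isStrictlyPositive_iff_eq_star_mul_self.2 ⟨u, u.isUnit, rfl⟩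
  have hcomm : ∀ x, Commute z x := by
    intro x
    have h1 : φ x * u = u * x := by rw [h]; simp
    have h2 : star (u : B) * φ x = x * star (u : B) := by
      have := h (star x)
      rw [map_star] at this
      have h3 : star (φ x) * u = u * star x := by rw [this]; simp
      simpa using congrArg star h3
    rw [commute_iff_eq, hz, mul_assoc, ← h1, ← mul_assoc, h2, mul_assoc]
  set r : B := z ^ (-(1 / 2) : ℝ) with hr
  have hrc : ∀ x, Commute r x := fun x => (hcomm x).cfc_nnreal _
  have hrz : r * z * r = 1 := CFC.conjugate_rpow_neg_one_half z hpos
  have hrs : star r = r := (CFC.rpow_nonneg (a := z)).isSelfAdjoint.star_eq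
  have hv1 : star ((u : B) * r) * (u * r) = 1 := by
    rw [star_mul, hrs, ← hrz, hz]; simp only [mul_assoc]
  have hur : IsUnit r := hpos.isUnit.cfcRpow _ hpos.nonneg
  have hv2 : ((u : B) * r) * star (u * r) = 1 := by
    obtain ⟨w, hw⟩ := u.isUnit.mul hur
    rw [← hw] at hv1 ⊢
    rw [Units.eq_inv_of_mul_eq_one_right hv1, Units.mul_inv]
  refine ⟨⟨u * r, hv1, hv2⟩, ?_⟩
  ext x
  rw [Unitary.conjStarAlgAut_apply, h]
  have h5 : (u : B) * r * x = (u * x * (u⁻¹ : Bˣ)) * (u * r) := by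
    simp only [mul_assoc, Units.inv_mul_cancel_left, (hrc x).eq]
  change (u : B) * r * x * star ((u : B) * r) = _
  rw [h5, mul_assoc, hv2, mul_one]

theorem isTorsionFree_additive {L : Type*} [CommGroup L]
    (htf : ∀ g : L, ∀ n : ℕ, n ≠ 0 → g ^ n = 1 → g = 1) : Module.IsTorsionFree ℤ (Additive L) := by
  refine .of_smul_eq_zero fun n x h => ?_
  by_contra! hc
  refine hc.2 (htf x.toMul n.natAbs (by simpa using hc.1) ?_)
  have h' : x.toMul ^ n = 1 := h
  rcases Int.natAbs_eq n with h1 | h1 <;> rw [h1] at h' <;> simpa using h'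

theorem eq_one_of_forall_exists_pow_factorial {L : Type*} [CommGroup L] [Group.FG L]
    (htf : ∀ g : L, ∀ n : ℕ, n ≠ 0 → g ^ n = 1 → g = 1) (g : L)
    (hg : ∀ k : ℕ, ∃ h : L, h ^ k.factorial = g) : g = 1 := by
  have : Module.Finite ℤ (Additive L) := Module.Finite.iff_addGroup_fg.2 inferInstance
  have := isTorsionFree_additive htf
  let b := Module.Free.chooseBasis ℤ (Additive L)
  have key : Additive.ofMul g = 0 := by
    refine b.ext_elem fun i => ?_
    obtain ⟨h, hh⟩ := hg ((b.repr (Additive.ofMul g) i).natAbs + 1)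
    rw [map_zero, Finsupp.zero_apply]
    set m := b.repr (Additive.ofMul g) i with hm
    refine Int.eq_zero_of_abs_lt_dvd (m := ((m.natAbs + 1).factorial : ℤ)) ?_ ?_
    · nth_rw 2 [hm]
      rw [← hh, ofMul_pow, map_nsmul, Finsupp.smul_apply, nsmul_eq_mul]
      exact dvd_mul_right _ _
    · rw [Int.abs_eq_natAbs]
      exact_mod_cast (Nat.lt_succ_self _).trans_le (Nat.self_le_factorial _)
  exact key

theorem exists_pow_torsionFree (G : Type*) [CommGroup G] [Group.FG G] :
    ∃ M : ℕ, M ≠ 0 ∧ ∀ g : G, ∀ n : ℕ, n ≠ 0 → g ^ n = 1 → g ^ M = 1 := by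
  have : Module.Finite ℤ (Additive G) := Module.Finite.iff_addGroup_fg.2 inferInstance
  have : Finite (Submodule.torsion ℤ (Additive G)) :=
    Module.finite_of_fg_torsion _ (Submodule.torsion_isTorsion (R := ℤ) (M := Additive G))
  refine ⟨Nat.card (Submodule.torsion ℤ (Additive G)), Nat.card_pos.ne', fun g n hn hg => ?_⟩
  have hmem : Additive.ofMul g ∈ Submodule.torsion ℤ (Additive G) := by
    have h0 : (n : ℤ) • Additive.ofMul g = 0 := by
      rw [natCast_zsmul, ← ofMul_pow, hg, ofMul_one]
    exact (Submodule.mem_torsion_iff (R := ℤ) (M := Additive G) _).2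
      ⟨⟨(n : ℤ), mem_nonZeroDivisors_of_ne_zero (by exact_mod_cast hn)⟩, h0⟩
  have := card_nsmul_eq_zero' (x := (⟨_, hmem⟩ : Submodule.torsion ℤ (Additive G)))
  exact congrArg Subtype.val this

open scoped IsMulCommutative in
theorem exists_monoidHom_lift {L U T : Type*} [CommGroup L] [Group.FG L] [Group U] [Group T]
    (htf : ∀ g : L, ∀ n : ℕ, n ≠ 0 → g ^ n = 1 → g = 1) (α : L →* T) (c : U →* T) (v : L → U)
    (hv : ∀ t, c (v t) = α t) (hcomm : ∀ s t, Commute (v s) (v t)) :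
    ∃ ψ : L →* U, ∀ t, c (ψ t) = α t := by
  have : Module.Finite ℤ (Additive L) := Module.Finite.iff_addGroup_fg.2 inferInstance
  have := isTorsionFree_additive htf
  let b := Module.Free.chooseBasis ℤ (Additive L)
  let C := Subgroup.closure (Set.range v)
  have : IsMulCommutative C := Subgroup.isMulCommutative_closure (by
    rintro _ ⟨s, rfl⟩ _ ⟨t, rfl⟩; exact hcomm s t)
  let f : Additive L →ₗ[ℤ] Additive C := b.constr ℤ fun i =>
    Additive.ofMul ⟨v (b i).toMul, Subgroup.subset_closure ⟨_, rfl⟩⟩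
  let ψ : L →* U := C.subtype.comp (AddMonoidHom.toMultiplicative f.toAddMonoidHom)
  refine ⟨ψ, fun t => ?_⟩
  have hb : ∀ i, ψ (b i).toMul = v (b i).toMul := fun i => by
    have : f (b i) = Additive.ofMul ⟨v (b i).toMul, Subgroup.subset_closure ⟨_, rfl⟩⟩ :=
      b.constr_basis ℤ _ i
    change ((f (b i)).toMul : U) = _
    rw [this]; rfl
  refine Submodule.span_induction (R := ℤ) (M := Additive L) (s := Set.range b)
    (p := fun x _ => c (ψ x.toMul) = α x.toMul) ?_ ?_ ?_ ?_ (x := Additive.ofMul t) ?_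
  · rintro _ ⟨i, rfl⟩
    rw [hb, hv]
  · simp
  · intro x y _ _ hx hy
    simp [hx, hy]
  · intro n x _ hx
    simp [hx]
  · rw [b.span_eq]
    trivial

theorem CStarAlgebra.exists_algEquiv_pi_matrix (B : Type*) [CStarAlgebra B]
    [FiniteDimensional ℂ B] : ∃ (n : ℕ) (d : Fin n → ℕ), (∀ i, NeZero (d i)) ∧
      Nonempty (B ≃ₐ[ℂ] Π i, Matrix (Fin (d i)) (Fin (d i)) ℂ) :=
  have := CStarAlgebra.isSemisimpleRing B
  IsSemisimpleRing.exists_algEquiv_pi_matrix_of_isAlgClosed ℂ B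

/-- Some fixed power of every ⋆-automorphism of a finite-dimensional C⋆-algebra is inner. -/
theorem CStarAlgebra.exists_pow_inner (B : Type*) [CStarAlgebra B] [FiniteDimensional ℂ B] :
    ∃ M : ℕ, M ≠ 0 ∧ ∀ φ : B ≃⋆ₐ[ℂ] B, ∃ v : unitary B, Unitary.conjStarAlgAut ℂ B v = φ ^ M := by
  classical
  obtain ⟨n, d, -, ⟨e⟩⟩ := CStarAlgebra.exists_algEquiv_pi_matrix B
  let S : Set B := {z | IsIdempotentElem z ∧ ∀ x, Commute z x}
  have hS : S.Finite := by
    refine (Set.Finite.preimage e.injective.injOn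
      (pi_matrix_finite_central_idempotents (d := d))).subset ?_
    rintro z ⟨hz, hc⟩
    refine ⟨hz.map e, fun x => ?_⟩
    simpa using (hc (e.symm x)).map e
  have hφS : ∀ (φ : B ≃⋆ₐ[ℂ] B) z, z ∈ S → φ z ∈ S := by
    rintro φ z ⟨hz, hc⟩
    refine ⟨hz.map φ, fun x => ?_⟩
    simpa using (hc (φ.symm x)).map φ
  have := hS.to_subtype
  refine ⟨Nat.card (Equiv.Perm S), Nat.card_pos.ne', fun φ => ?_⟩
  let σ : Equiv.Perm S :=
    { toFun := fun z => ⟨φ z, hφS φ z z.2⟩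
      invFun := fun z => ⟨φ.symm z, hφS φ.symm z z.2⟩
      left_inv := fun z => by simp
      right_inv := fun z => by simp }
  have hσ : ∀ k : ℕ, ∀ z : S, ((σ ^ k) z : B) = (φ ^ k) z := by
    intro k
    induction k with
    | zero => intro z; rfl
    | succ k ih => intro z; rw [pow_succ, pow_succ]; exact ih (σ z)
  have hfix : ∀ z ∈ S, (φ ^ Nat.card (Equiv.Perm S)) z = z := fun z hz => by
    rw [← hσ _ ⟨z, hz⟩, pow_card_eq_one']
    rfl
  set ψ := φ ^ Nat.card (Equiv.Perm S)
  obtain ⟨u, hu⟩ := pi_matrix_exists_units_conj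
    (e.symm.trans (ψ.toAlgEquiv.trans e)) (fun i => by
      have hmem : e.symm (Pi.single i 1) ∈ S := by
        have h1 : IsIdempotentElem
            (Pi.single i 1 : Π i, Matrix (Fin (d i)) (Fin (d i)) ℂ) := by
          funext j
          rcases eq_or_ne j i with rfl | hj <;> simp [*]
        have h2 : ∀ x, Commute (Pi.single i 1 : Π i, Matrix (Fin (d i)) (Fin (d i)) ℂ) x := by
          intro x
          funext j
          rcases eq_or_ne j i with rfl | hj <;> simp [*]
        refine ⟨h1.map e.symm, fun x => ?_⟩
        simpa using (h2 (e x)).map e.symm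
      have := hfix _ hmem
      change e (ψ (e.symm (Pi.single i 1))) = _
      rw [this, AlgEquiv.apply_symm_apply])
  refine exists_unitary_of_units ψ (Units.map (e.symm : _ →* B) u) fun x => ?_
  have := congrArg e.symm (hu (e x))
  rw [← map_inv]
  simpa using this

/-- If conjugations by two unitaries commute, then a fixed power of the one commutes with the
other. -/
theorem CStarAlgebra.exists_pow_commute (B : Type*) [CStarAlgebra B] [FiniteDimensional ℂ B] :
    ∃ N : ℕ, N ≠ 0 ∧ ∀ u v : unitary B,
      Commute (Unitary.conjStarAlgAut ℂ B u) (Unitary.conjStarAlgAut ℂ B v) →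
      Commute (u ^ N) v := by
  obtain ⟨n, d, hd, ⟨e⟩⟩ := CStarAlgebra.exists_algEquiv_pi_matrix B
  refine ⟨∏ i, d i, Finset.prod_ne_zero_iff.2 fun i _ => (hd i).out, fun u v huv => ?_⟩
  set c : unitary B := u * v * u⁻¹ * v⁻¹ with hc
  have hc1 : Unitary.conjStarAlgAut ℂ B c = 1 := by
    rw [hc, map_mul, map_mul, map_mul, map_inv, map_inv, huv.eq]
    group
  have hcc : ∀ x : B, Commute (c : B) x := fun x => by
    have h1 : (c : B) * x * star (c : B) = x := DFunLike.congr_fun hc1 x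
    rw [commute_iff_eq]
    nth_rw 2 [← h1]
    rw [mul_assoc, Unitary.coe_star_mul_self, mul_one]
  let E : unitary B →* (Π i, Matrix (Fin (d i)) (Fin (d i)) ℂ)ˣ :=
    (Units.map (e : B →* Π i, Matrix (Fin (d i)) (Fin (d i)) ℂ)).comp Unitary.toUnits
  have hE : Function.Injective E := fun a b hab => by
    have h1 : e a = e b := congrArg Units.val hab
    exact Subtype.ext (e.injective h1)
  have hcE : E c = E u * E v * (E u)⁻¹ * (E v)⁻¹ := by simp [hc]
  have hcN : c ^ ∏ i, d i = 1 := by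
    apply hE
    rw [map_pow, map_one, hcE]
    apply pi_matrix_pow_eq_one
    rw [← hcE]
    intro z
    have := (hcc (e.symm z)).map e
    rwa [AlgEquiv.apply_symm_apply] at this
  have hcg : ∀ w : unitary B, Commute c w := fun w => Subtype.ext (hcc w)
  have h1 : SemiconjBy v (c * u) u := by
    rw [SemiconjBy, ← mul_assoc, ← (hcg v).eq, hc]
    group
  have h2 := h1.pow_right (∏ i, d i)
  rw [(hcg u).mul_pow, hcN, one_mul] at h2
  exact Commute.symm h2

theorem CStarAlgebra.exists_monoidHom_unitary {G B : Type*} [CommGroup G] [CStarAlgebra B]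
    [FiniteDimensional ℂ B] (α : G →* (B ≃⋆ₐ[ℂ] B)) :
    ∃ N : ℕ, N ≠ 0 ∧ ∀ L : Subgroup G, Group.FG L →
      (∀ g ∈ L, ∀ n : ℕ, n ≠ 0 → g ^ n = 1 → g = 1) → (∀ g ∈ L, ∃ h : G, h ^ N = g) →
      ∃ ψ : L →* unitary B, ∀ t : L, Unitary.conjStarAlgAut ℂ B (ψ t) = α t := by
  obtain ⟨M, hM, hMv⟩ := CStarAlgebra.exists_pow_inner B
  obtain ⟨N, hN, hNc⟩ := CStarAlgebra.exists_pow_commute B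
  refine ⟨M * N, mul_ne_zero hM hN, fun L _ htf hL => ?_⟩
  choose u hu using fun g : G => hMv (α g)
  choose r hr using fun t : L => hL t t.2
  refine exists_monoidHom_lift (fun g n hn hg => Subtype.ext
    (htf g g.2 n hn (by simpa using congrArg Subtype.val hg))) (α.comp L.subtype)
    (Unitary.conjStarAlgAut ℂ B) (fun t => u (r t) ^ N) (fun t => ?_) (fun s t => ?_)
  · rw [map_pow, hu, ← pow_mul, ← map_pow, hr]
    rfl
  · refine (hNc _ _ ?_).pow_right N
    rw [hu, hu]
    exact ((Commute.all (r s) (r t)).map α).pow_pow _ _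

theorem NonUnitalCStarAlgebra.exists_unitary_implementation {G B : Type*} [CommGroup G]
    [NonUnitalCStarAlgebra B] [FiniteDimensional ℂ B] (α : G → B ≃⋆ₐ[ℂ] B)
    (hα : ∀ g h x, α (g * h) x = α g (α h x)) :
    ∃ N : ℕ, N ≠ 0 ∧ ∀ L : Subgroup G, Group.FG L →
      (∀ g ∈ L, ∀ n : ℕ, n ≠ 0 → g ^ n = 1 → g = 1) → (∀ g ∈ L, ∃ h : G, h ^ N = g) →
      ∃ (e : B) (w : G → B), (∀ x, e * x = x ∧ x * e = x) ∧ w 1 = e ∧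
        (∀ s ∈ L, ∀ t ∈ L, w (s * t) = w s * w t) ∧
        (∀ t ∈ L, w t * star (w t) = e ∧ star (w t) * w t = e) ∧
        (∀ t ∈ L, ∀ x, α t x = w t * x * star (w t)) := by
  classical
  obtain ⟨e, he⟩ := exists_unit_of_finiteDimensional B
  let _ : CStarAlgebra B := CStarAlgebra.ofUnit e he
  let β : G →* (B ≃⋆ₐ[ℂ] B) := MonoidHom.mk' α (fun g h => StarAlgEquiv.ext (hα g h))
  obtain ⟨N, hN, H⟩ := CStarAlgebra.exists_monoidHom_unitary β
  refine ⟨N, hN, fun L hfg htf hL => ?_⟩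
  obtain ⟨ψ, hψ⟩ := H L hfg htf hL
  let w : G → B := fun g => if hg : g ∈ L then (ψ ⟨g, hg⟩ : B) else 1
  have hw : ∀ t (ht : t ∈ L), w t = ψ ⟨t, ht⟩ := fun t ht => dif_pos ht
  refine ⟨e, w, he, ?_, ?_, ?_, ?_⟩
  · rw [hw 1 L.one_mem]
    exact congrArg Subtype.val (map_one ψ)
  · intro s hs t ht
    rw [hw s hs, hw t ht, hw _ (L.mul_mem hs ht)]
    exact congrArg Subtype.val (map_mul ψ ⟨s, hs⟩ ⟨t, ht⟩)
  · intro t ht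
    rw [hw t ht]
    exact ⟨Unitary.coe_mul_star_self _, Unitary.coe_star_mul_self _⟩
  · intro t ht x
    rw [hw t ht]
    exact (DFunLike.congr_fun (hψ ⟨t, ht⟩) x).symm


/-- Let `G` be a finitely generated abelian group acting on a C*-algebra `A` by
⋆-automorphisms, leaving invariant each member of an increasing sequence `(R n)` of
finite-dimensional ⋆-subalgebras. Then there is a dominating regular approximation
`(H k)` of `G` by finite-index free (torsion-free) subgroups such that for all `k ≥ n`
the action of `H k` on `R n` is unitarily implemented inside `R n`. -/
theorem stmt_9 {G A : Type*} [CommGroup G] (hfg : Group.FG G)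
    [NonUnitalNormedRing A] [StarRing A] [CStarRing A]
    [NormedSpace ℂ A] [IsScalarTower ℂ A A] [SMulCommClass ℂ A A] [StarModule ℂ A]
    [CompleteSpace A]
    (α : G → A ≃⋆ₐ[ℂ] A)
    (hα1 : ∀ a : A, α 1 a = a)
    (hαm : ∀ (g h : G) (a : A), α (g * h) a = α g (α h a))
    (R : ℕ → NonUnitalStarSubalgebra ℂ A)
    (hRmono : ∀ n, R n ≤ R (n + 1))
    (hRfd : ∀ n, FiniteDimensional ℂ (R n))
    (hRinv : ∀ (g : G) (n : ℕ), ∀ x ∈ R n, α g x ∈ R n) :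
    ∃ H : ℕ → Subgroup G,
      -- decreasing sequence of finite-index subgroups, each free as an abelian group:
      (∀ k, H (k + 1) ≤ H k) ∧
      (∀ k, (H k).FiniteIndex) ∧
      (∀ k, ∀ g ∈ H k, ∀ n : ℕ, n ≠ 0 → g ^ n = 1 → g = 1) ∧
      -- regular approximation:
      (∀ g : G, g ≠ 1 → ∃ k, g ∉ H k) ∧
      -- dominating:
      (∀ K : Subgroup G, K.FiniteIndex → ∃ k, H k ≤ K) ∧
      -- for k ≥ n the restriction of the action to H k is unitary on R n, i.e. it is
      -- implemented by a group homomorphism from H k to the unitary group of R n: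
      (∀ n k : ℕ, n ≤ k →
        ∃ (e : A) (w : G → A),
          e ∈ R n ∧
          (∀ x ∈ R n, e * x = x ∧ x * e = x) ∧
          (∀ t ∈ H k, w t ∈ R n) ∧
          w 1 = e ∧
          (∀ s ∈ H k, ∀ t ∈ H k, w (s * t) = w s * w t) ∧
          (∀ t ∈ H k, w t * star (w t) = e ∧ star (w t) * w t = e) ∧
          (∀ t ∈ H k, ∀ x ∈ R n, α t x = w t * x * star (w t))) := by
  classical
  have hRex : ∀ n, ∃ N : ℕ, N ≠ 0 ∧ ∀ L : Subgroup G, Group.FG L →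
      (∀ g ∈ L, ∀ m : ℕ, m ≠ 0 → g ^ m = 1 → g = 1) → (∀ g ∈ L, ∃ h : G, h ^ N = g) →
      ∃ (e : R n) (w : G → R n), (∀ x, e * x = x ∧ x * e = x) ∧ w 1 = e ∧
        (∀ s ∈ L, ∀ t ∈ L, w (s * t) = w s * w t) ∧
        (∀ t ∈ L, w t * star (w t) = e ∧ star (w t) * w t = e) ∧
        (∀ t ∈ L, ∀ x : R n, α t x = ((w t * x * star (w t) : R n) : A)) := by
    intro n
    let _ : NonUnitalCStarAlgebra A := { }
    have : FiniteDimensional ℂ (R n) := hRfd n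
    have : IsClosed (R n : Set A) :=
      Submodule.closed_of_finiteDimensional (R n).toNonUnitalSubalgebra.toSubmodule
    let β : G → (R n) ≃⋆ₐ[ℂ] (R n) := fun g =>
      { toFun := fun x => ⟨α g x, hRinv g n x x.2⟩
        invFun := fun x => ⟨α g⁻¹ x, hRinv g⁻¹ n x x.2⟩
        left_inv := fun x => Subtype.ext (by
          change α g⁻¹ (α g x) = x
          rw [← hαm, inv_mul_cancel, hα1])
        right_inv := fun x => Subtype.ext (by
          change α g (α g⁻¹ x) = x
          rw [← hαm, mul_inv_cancel, hα1])
        map_mul' := fun x y => Subtype.ext (map_mul (α g) _ _)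
        map_add' := fun x y => Subtype.ext (map_add (α g) _ _)
        map_star' := fun x => Subtype.ext (map_star (α g) _)
        map_smul' := fun r x => Subtype.ext (map_smul (α g) _ _) }
    obtain ⟨N, hN, H⟩ := NonUnitalCStarAlgebra.exists_unitary_implementation β
      (fun g h x => Subtype.ext (hαm g h x))
    refine ⟨N, hN, fun L h1 h2 h3 => ?_⟩
    obtain ⟨e, w, he, hw1, hwm, hwu, hwα⟩ := H L h1 h2 h3
    exact ⟨e, w, he, hw1, hwm, hwu, fun t ht x => congrArg Subtype.val (hwα t ht x)⟩
  choose N hN hNw using hRex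
  obtain ⟨M, hM, hMt⟩ := exists_pow_torsionFree G
  let f : ℕ → ℕ := fun k => M * (k.factorial * ∏ n ∈ Finset.range (k + 1), N n)
  have hf0 : ∀ k, f k ≠ 0 := fun k => mul_ne_zero hM (mul_ne_zero k.factorial_ne_zero
    (Finset.prod_ne_zero_iff.2 fun n _ => hN n))
  let H : ℕ → Subgroup G := fun k => (powMonoidHom (f k) : G →* G).range
  have hmem : ∀ k m g, m ∣ f k → g ∈ H k → ∃ h : G, h ^ m = g := by
    rintro k m _ ⟨c, hc⟩ ⟨h, rfl⟩
    exact ⟨h ^ c, by rw [← pow_mul, powMonoidHom_apply, hc, mul_comm]⟩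
  have htfM : ∀ h : G, ∀ n : ℕ, n ≠ 0 → (h ^ M) ^ n = 1 → h ^ M = 1 := fun h n hn hh =>
    hMt h (M * n) (mul_ne_zero hM hn) (by rw [pow_mul, hh])
  have htf : ∀ k, ∀ g ∈ H k, ∀ n : ℕ, n ≠ 0 → g ^ n = 1 → g = 1 := by
    intro k g hg n hn hgn
    obtain ⟨h, rfl⟩ := hmem k M g (dvd_mul_right _ _) hg
    exact htfM h n hn hgn
  refine ⟨H, ?_, fun k => Subgroup.finiteIndex_range_powMonoidHom_of_fg G (hf0 k),
    htf, ?_, ?_, ?_⟩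
  · intro k g hg
    obtain ⟨h, rfl⟩ := hmem (k + 1) (f k) g (mul_dvd_mul_left _ (mul_dvd_mul
      (Nat.factorial_dvd_factorial k.le_succ)
      (Finset.prod_dvd_prod_of_subset _ _ _ (Finset.range_mono (by omega))))) hg
    exact ⟨h, rfl⟩
  · intro g hg
    by_contra! hall
    obtain ⟨g₀, rfl⟩ := hmem 0 M g (dvd_mul_right _ _) (hall 0)
    let L : Subgroup G := (powMonoidHom M : G →* G).range
    have := eq_one_of_forall_exists_pow_factorial (L := L) (by
      rintro ⟨_, h, rfl⟩ n hn hh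
      exact Subtype.ext (htfM h n hn (by simpa using congrArg Subtype.val hh)))
      ⟨g₀ ^ M, g₀, rfl⟩ (by
        intro k
        obtain ⟨h, hh⟩ := hmem k (M * k.factorial) _
          (mul_dvd_mul_left _ (dvd_mul_right _ _)) (hall k)
        exact ⟨⟨h ^ M, h, rfl⟩, Subtype.ext (by simpa [pow_mul] using hh)⟩)
    exact hg (congrArg Subtype.val this)
  · intro K hK
    refine ⟨K.index, fun g hg => ?_⟩
    obtain ⟨h, rfl⟩ := hmem K.index K.index g (Dvd.dvd.mul_left (Dvd.dvd.mul_right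
      (Nat.dvd_factorial (Nat.pos_of_ne_zero hK.index_ne_zero) le_rfl) _) _) hg
    exact K.pow_index_mem h
  · intro n k hnk
    obtain ⟨e, w, he, hw1, hwm, hwu, hwα⟩ := hNw n (H k) inferInstance (htf k)
      (fun g hg => hmem k (N n) g (Dvd.dvd.mul_left (Dvd.dvd.mul_left
        (Finset.dvd_prod_of_mem N (Finset.mem_range.2 (by omega))) _) _) hg)
    refine ⟨e, fun t => w t, e.2, fun x hx => ?_, fun t _ => (w t).2, congrArg Subtype.val hw1,
      fun s hs t ht => congrArg Subtype.val (hwm s hs t ht), fun t ht => ?_, fun t ht x hx => ?_⟩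
    · exact ⟨congrArg Subtype.val (he ⟨x, hx⟩).1, congrArg Subtype.val (he ⟨x, hx⟩).2⟩
    · exact ⟨congrArg Subtype.val (hwu t ht).1, congrArg Subtype.val (hwu t ht).2⟩
    · exact hwα t ht ⟨x, hx⟩
end

section
/- Let A be a unital C*-algebra, α a ⋆-automorphism of A, D ⊆ A a ⋆-subalgebra, ε > 0, m ≥ 1, and B_1, …, B_m ⋆-subalgebras of A with D ⊆ B_j for all j. Assume that for each 1 ≤ j ≤ m and each x in the closed unit ball of B_j there is y in the closed unit ball of B_{j+1} with ‖α(x) − y‖ < ε (indices taken cyclically, B_{m+1} := B_1). Set δ := ε/(3(m+1)) and let e_1, …, e_m be pairwise orthogonal projections in A such that: ‖x e_i − e_i x‖ < δ for all i and all x in the closed unit balls of the B_j and of the α(B_j); ‖1_A − Σ_{i=1}^m e_i‖ < δ; and ‖α(e_i) − e_{i+1}‖ < δ (with e_{m+1} := e_1). Then: (1) for every a in the closed unit ball of D there exist x_1, …, x_m with each x_j in the closed unit ball of B_j such that ‖a − Σ_{j=1}^m e_j x_j e_j‖ < ε; and (2) for all x_1, …, x_m with each x_j in the closed unit ball of B_j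 there exist y_1, …, y_m with each y_j in the closed unit ball of B_j such that ‖α(Σ_{j=1}^m e_j x_j e_j) − Σ_{j=1}^m e_j y_j e_j‖ < 2ε. -/
open Finset

/-- A finite sum of pairwise orthogonal star projections is a star projection. -/
lemma isStarProjection_sum_of_pairwise_mul_eq_zero {ι R : Type*} [Fintype ι]
    [NonUnitalSemiring R] [StarRing R] {e : ι → R} (he : ∀ i, IsStarProjection (e i))
    (horth : ∀ i j, i ≠ j → e i * e j = 0) : IsStarProjection (∑ i, e i) where
  isIdempotentElem := by
    rw [IsIdempotentElem, sum_mul_sum]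
    refine sum_congr rfl fun i _ ↦ ?_
    rw [sum_eq_single i (fun j _ hj ↦ horth i j hj.symm) (by simp)]
    exact (he i).isIdempotentElem
  isSelfAdjoint := isSelfAdjoint_sum _ fun i _ ↦ (he i).isSelfAdjoint

/-- A finite sum of corners `e i * z i * e i` along pairwise orthogonal projections has norm at
most any common bound of the norms of the `z i`. -/
lemma CStarAlgebra.norm_sum_corner_le {ι A : Type*} [Fintype ι] [CStarAlgebra A] {e : ι → A}
    (he : ∀ i, IsStarProjection (e i)) (horth : ∀ i j, i ≠ j → e i * e j = 0)
    {c : ℝ} (hc : 0 ≤ c) {z : ι → A} (hz : ∀ i, ‖z i‖ ≤ c) :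
    ‖∑ i, e i * z i * e i‖ ≤ c := by
  let _ := CStarAlgebra.spectralOrder A
  let _ := CStarAlgebra.spectralOrderedRing A
  have hstar : star (∑ i, e i * z i * e i) * (∑ i, e i * z i * e i) =
      ∑ i, star (e i) * (star (e i * z i) * (e i * z i)) * e i := by
    rw [star_sum, sum_mul_sum]
    refine sum_congr rfl fun i _ ↦ ?_
    rw [sum_eq_single i _ (by simp)]
    · simp only [star_mul, mul_assoc]
    · intro j _ hj
      have h : e i * (e j * z j * e j) = 0 := by
        rw [← mul_assoc, ← mul_assoc, horth i j hj.symm, zero_mul, zero_mul]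
      simp only [star_mul, (he i).isSelfAdjoint.star_eq, mul_assoc] at h ⊢
      simp [h]
  have hle : star (∑ i, e i * z i * e i) * (∑ i, e i * z i * e i) ≤ c ^ 2 • ∑ i, e i := by
    rw [hstar, smul_sum]
    refine sum_le_sum fun i _ ↦ ?_
    have hn : ‖e i * z i‖ ≤ c :=
      (norm_mul_le_of_le (he i).norm_le (hz i)).trans_eq (one_mul c)
    have h1 : star (e i * z i) * (e i * z i) ≤ algebraMap ℝ A (c ^ 2) := by
      refine CStarAlgebra.star_mul_le_algebraMap_norm_sq.trans ?_
      exact algebraMap_mono A (by gcongr)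
    refine (star_left_conjugate_le_conjugate h1 (e i)).trans_eq ?_
    rw [← Algebra.commutes, mul_assoc, (he i).isSelfAdjoint.star_eq,
      (he i).isIdempotentElem.eq, Algebra.smul_def]
  have hsq : ‖∑ i, e i * z i * e i‖ ^ 2 ≤ c ^ 2 := by
    rw [sq, ← CStarRing.norm_star_mul_self]
    refine (CStarAlgebra.norm_le_norm_of_nonneg_of_le (star_mul_self_nonneg _) hle).trans ?_
    rw [norm_smul, Real.norm_of_nonneg (sq_nonneg c)]
    exact mul_le_of_le_one_right (sq_nonneg c)
      (isStarProjection_sum_of_pairwise_mul_eq_zero he horth).norm_le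
  exact le_of_sq_le_sq hsq hc

/-- If `p` and `q` are contractions within `δ` of each other and `x` is a contraction, then the
corners `p * x * p` and `q * x * q` are within `2 * δ` of each other. -/
lemma norm_corner_sub_corner_le {R : Type*} [NormedRing R] {p q x : R} {δ : ℝ}
    (hp : ‖p‖ ≤ 1) (hq : ‖q‖ ≤ 1) (hx : ‖x‖ ≤ 1) (hpq : ‖p - q‖ ≤ δ) :
    ‖p * x * p - q * x * q‖ ≤ 2 * δ := by
  have h : p * x * p - q * x * q = (p - q) * (x * p) + q * x * (p - q) := by noncomm_ring
  have hxp : ‖x * p‖ ≤ 1 := (norm_mul_le_of_le hx hp).trans_eq (one_mul 1)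
  have hqx : ‖q * x‖ ≤ 1 := (norm_mul_le_of_le hq hx).trans_eq (one_mul 1)
  calc ‖p * x * p - q * x * q‖ ≤ δ * 1 + 1 * δ := by
        rw [h]
        exact norm_add_le_of_le (norm_mul_le_of_le hpq hxp) (norm_mul_le_of_le hqx hpq)
    _ = 2 * δ := by ring


/-- The key approximation step in the proof that an approximately inner automorphism with
the Rokhlin property is an almost inductive limit automorphism: given cyclically
`ε`-related finite towers `B j` containing `D` and a Rokhlin family of projections `e j`
(with `δ = ε / (3(m+1))`), every contraction in `D` is `ε`-close to an element of
`∑ e j B j e j`, and `α` moves `∑ e j x j e j` at most `2ε` away from such a sum. -/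
theorem stmt_12 {A : Type*} [NormedRing A] [StarRing A] [CStarRing A]
    [NormedAlgebra ℂ A] [StarModule ℂ A] [CompleteSpace A]
    (α : A ≃⋆ₐ[ℂ] A)
    (D : NonUnitalStarSubalgebra ℂ A)
    (ε : ℝ) (hε : 0 < ε)
    (m : ℕ) [NeZero m] (hm : 1 ≤ m)
    (B : ZMod m → NonUnitalStarSubalgebra ℂ A)
    (hDB : ∀ j, D ≤ B j)
    (happrox : ∀ j : ZMod m, ∀ x ∈ B j, ‖x‖ ≤ 1 →
      ∃ y ∈ B (j + 1), ‖y‖ ≤ 1 ∧ ‖α x - y‖ < ε)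
    (δ : ℝ) (hδ : δ = ε / (3 * ((m : ℝ) + 1)))
    (e : ZMod m → A)
    (hproj : ∀ i, IsSelfAdjoint (e i) ∧ e i * e i = e i)
    (horth : ∀ i j, i ≠ j → e i * e j = 0)
    (hcomm : ∀ (i j : ZMod m), ∀ x ∈ B j, ‖x‖ ≤ 1 →
      ‖x * e i - e i * x‖ < δ ∧ ‖α x * e i - e i * α x‖ < δ)
    (hsum : ‖(1 : A) - ∑ i, e i‖ < δ)
    (hcyc : ∀ i, ‖α (e i) - e (i + 1)‖ < δ) :
    (∀ a ∈ D, ‖a‖ ≤ 1 →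
      ∃ x : ZMod m → A, (∀ j, x j ∈ B j ∧ ‖x j‖ ≤ 1) ∧
        ‖a - ∑ j, e j * x j * e j‖ < ε) ∧
    (∀ x : ZMod m → A, (∀ j, x j ∈ B j ∧ ‖x j‖ ≤ 1) →
      ∃ y : ZMod m → A, (∀ j, y j ∈ B j ∧ ‖y j‖ ≤ 1) ∧
        ‖α (∑ j, e j * x j * e j) - ∑ j, e j * y j * e j‖ < 2 * ε) := by
  let _ : CStarAlgebra A := {}
  have he : ∀ i, IsStarProjection (e i) := fun i ↦ ⟨(hproj i).2, (hproj i).1⟩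
  have hδm : ((m : ℝ) + 1) * δ = ε / 3 := by rw [hδ]; field_simp
  have hδ0 : 0 < δ := by rw [hδ]; positivity
  have hα : ∀ x, ‖α x‖ ≤ ‖x‖ := fun x ↦ (NonUnitalStarAlgHom.norm_map α α.injective x).le
  refine ⟨fun a ha ha1 ↦ ⟨fun _ ↦ a, fun j ↦ ⟨hDB j ha, ha1⟩, ?_⟩, fun x hx ↦ ?_⟩
  · have hsplit : a - ∑ j, e j * a * e j =
        a * (1 - ∑ j, e j) + ∑ j, (a * e j - e j * a) * e j := by
      simp only [sub_mul, sum_sub_distrib, mul_sub, mul_one, mul_sum, mul_assoc,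
        (he _).isIdempotentElem.eq]
      abel
    have hterm : ∀ j, ‖(a * e j - e j * a) * e j‖ ≤ δ := fun j ↦
      (norm_mul_le_of_le (hcomm j j a (hDB j ha) ha1).1.le (he j).norm_le).trans_eq (mul_one δ)
    calc ‖a - ∑ j, e j * a * e j‖ ≤ 1 * δ + ∑ _j : ZMod m, δ := by
          rw [hsplit]
          exact norm_add_le_of_le (norm_mul_le_of_le ha1 hsum.le)
            (norm_sum_le_of_le _ fun j _ ↦ hterm j)
      _ = ε / 3 := by simp [ZMod.card, ← hδm]; ring
      _ < ε := by linarith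
  · choose y hyB hy1 hy using fun j ↦ happrox j (x j) (hx j).1 (hx j).2
    have hreindex : ∀ z : ZMod m → A, ∑ j, z (j + 1) = ∑ j, z j :=
      fun z ↦ Equiv.sum_comp (Equiv.addRight (1 : ZMod m)) z
    refine ⟨fun j ↦ y (j - 1), fun j ↦ ⟨?_, hy1 _⟩, ?_⟩
    · simpa using hyB (j - 1)
    rw [← hreindex (fun j ↦ e j * y (j - 1) * e j)]
    have hsplit : α (∑ j, e j * x j * e j) - ∑ j, e (j + 1) * y (j + 1 - 1) * e (j + 1) =
        ∑ j, (α (e j) * α (x j) * α (e j) - e (j + 1) * α (x j) * e (j + 1)) +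
          ∑ j, e (j + 1) * (α (x j) - y j) * e (j + 1) := by
      simp only [map_sum, map_mul, add_sub_cancel_right, mul_sub, sub_mul, sum_sub_distrib]
      abel
    have hterm : ∀ j, ‖α (e j) * α (x j) * α (e j) - e (j + 1) * α (x j) * e (j + 1)‖ ≤ 2 * δ :=
      fun j ↦ norm_corner_sub_corner_le ((hα _).trans (he j).norm_le) (he _).norm_le
        ((hα _).trans (hx j).2) (hcyc j).le
    calc ‖α (∑ j, e j * x j * e j) - ∑ j, e (j + 1) * y (j + 1 - 1) * e (j + 1)‖
        ≤ ∑ _j : ZMod m, 2 * δ + ε := by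
          rw [hsplit]
          exact norm_add_le_of_le (norm_sum_le_of_le _ fun j _ ↦ hterm j)
            (CStarAlgebra.norm_sum_corner_le (fun j ↦ he (j + 1))
              (fun i j hij ↦ horth _ _ (by simpa using hij)) hε.le fun j ↦ (hy j).le)
      _ = m * (2 * δ) + ε := by simp [ZMod.card]
      _ < 2 * ε := by linarith
end
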